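/- Let p be a fixed point of J, let q be the next fixed point after p (i.e., q is a fixed point, q > p, and there is no fixed point strictly between p and q), and let m̄ be the 2-adic valuation of 3·p + 2 (the largest m with 2^m dividing 3·p + 2). Then 2^{m̄+1}·q = 3^{m̄}·(3·p + 2) − 2^{m̄}, i.e., q = (3^{m̄}·(3·p + 2) − 2^{m̄}) / 2^{m̄+1}. -/

import Mathlib

/-- The Josephus function with reduction constant 3:
`J 1 = 1` and `J n = ((J (n-1) + 2) % n) + 1` for `n ≥ 2`. -/
def J : ℕ → ℕ
  | 0 => 0
  | 1 => 1
  | n + 2 => (J (n + 1) + 2) % (n + 2) + 1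

/-- `n ≥ 1` is a high extremal point if `J n ∈ {n-1, n}`. -/
def IsHighExtremal (n : ℕ) : Prop := 1 ≤ n ∧ (J n = n - 1 ∨ J n = n)

theorem J_succ {n : ℕ} (hn : 1 ≤ n) : J (n + 1) = (J n + 2) % (n + 1) + 1 := by
  obtain ⟨m, rfl⟩ : ∃ m, n = m + 1 := ⟨n - 1, by omega⟩
  rfl

/-- As long as no wrap-around occurs, `J` grows by `3` at each step. -/
theorem J_add {n : ℕ} (hn : 1 ≤ n) (k : ℕ) (h : J n + 3 * k ≤ n + k) :
    J (n + k) = J n + 3 * k := by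
  induction k with
  | zero => rfl
  | succ k ih =>
    rw [← Nat.add_assoc, J_succ (by omega), ih (by omega), Nat.mod_eq_of_lt (by omega)]
    ring

theorem J_add_of_fixed {n : ℕ} (hn : 1 ≤ n) (hJ : J n = n) (k : ℕ) (hk : 2 * k + 1 ≤ n) :
    J (n + 1 + k) = 2 + 3 * k := by
  have h : J (n + 1) = 2 := by
    rw [J_succ hn, hJ, show n + 2 = 1 + (n + 1) by ring, Nat.add_mod_right,
      Nat.mod_eq_of_lt (by omega)]
  rw [J_add (by omega) k (by omega), h]

theorem J_add_of_pure {n : ℕ} (hn : 1 ≤ n) (hJ : J n + 1 = n) (k : ℕ) (hk : 2 * k ≤ n) :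
    J (n + 1 + k) = 1 + 3 * k := by
  have h : J (n + 1) = 1 := by
    rw [J_succ hn, show J n + 2 = n + 1 by omega, Nat.mod_self]
  rw [J_add (by omega) k (by omega), h]

/-- The next fixed point after a pure high extremal point `n` with `n + 1 = 2 ^ v * c`, `c` odd. -/
theorem next_fixed_of_pure {q c : ℕ} (hq : J q = q) (hc : Odd c) (v : ℕ) {n : ℕ} (hn : 1 ≤ n)
    (hJ : J n + 1 = n) (hnc : n + 1 = 2 ^ v * c) (hlt : n < q)
    (hnext : ∀ k, n < k → k < q → J k ≠ k) :
    2 * q + 1 = 3 ^ (v + 1) * c := by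
  induction v generalizing n c with
  | zero =>
    obtain ⟨d, rfl⟩ := hc
    have hd : n = 2 * d := by omega
    have h₁ := J_add_of_pure hn hJ d (by omega)
    have h₂ : ¬ n + 1 + d < q := fun h => hnext _ (by omega) h (by omega)
    obtain ⟨k, rfl⟩ : ∃ k, q = n + 1 + k := ⟨q - (n + 1), by omega⟩
    have h₃ := J_add_of_pure hn hJ k (by omega)
    omega
  | succ v ih =>
    obtain ⟨d, hd⟩ : ∃ d, d = 2 ^ v * c := ⟨_, rfl⟩
    have hnd : n + 1 = 2 * d := by rw [hnc, hd]; ring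
    have h₁ := J_add_of_pure hn hJ (d - 1) (by omega)
    have h₂ : n + 1 + (d - 1) < q := by
      by_contra h
      obtain ⟨k, rfl⟩ : ∃ k, q = n + 1 + k := ⟨q - (n + 1), by omega⟩
      have h₃ := J_add_of_pure hn hJ k (by omega)
      omega
    have key := ih (c := 3 * c) (n := n + 1 + (d - 1)) (Odd.mul (by decide) hc) (by omega)
      (by omega) (by rw [show 2 ^ v * (3 * c) = 3 * (2 ^ v * c) by ring, ← hd]; omega) h₂
      (fun k hk => hnext k (by omega))
    rw [key]; ring

theorem stmt_11 (p q : ℕ) (hp1 : 1 ≤ p) (hp : J p = p)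
    (hq : J q = q) (hlt : p < q)
    (hnext : ∀ k, p < k → k < q → J k ≠ k)
    (mbar : ℕ) (hmbar : mbar = padicValNat 2 (3 * p + 2)) :
    2 ^ (mbar + 1) * q = 3 ^ mbar * (3 * p + 2) - 2 ^ mbar := by
  obtain ⟨c, hc⟩ : 2 ^ mbar ∣ 3 * p + 2 := hmbar ▸ pow_padicValNat_dvd
  have hodd : Odd c := by
    rw [← Nat.not_even_iff_odd, even_iff_two_dvd]
    rintro ⟨d, rfl⟩
    refine pow_succ_padicValNat_not_dvd (p := 2) (n := 3 * p + 2) (by omega) ?_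
    rw [← hmbar]
    exact ⟨d, by rw [hc]; ring⟩
  suffices h : 2 * q + 1 = 3 ^ mbar * c by
    rw [hc, show 3 ^ mbar * (2 ^ mbar * c) = 2 ^ mbar * (3 ^ mbar * c) by ring, ← h]
    refine (Nat.sub_eq_of_eq_add ?_).symm
    ring
  cases mbar with
  | zero =>
    obtain ⟨d, rfl⟩ := hodd
    have h₁ := J_add_of_fixed hp1 hp ((p - 1) / 2) (by omega)
    have h₂ : ¬ p + 1 + (p - 1) / 2 < q := fun h => hnext _ (by omega) h (by omega)
    obtain ⟨k, rfl⟩ : ∃ k, q = p + 1 + k := ⟨q - (p + 1), by omega⟩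
    have h₃ := J_add_of_fixed hp1 hp k (by omega)
    omega
  | succ v =>
    have hpc : 3 * p + 2 = 2 * (2 ^ v * c) := by rw [hc]; ring
    have h₁ := J_add_of_fixed hp1 hp ((p - 2) / 2) (by omega)
    have h₂ : p + 1 + (p - 2) / 2 < q := by
      by_contra h
      obtain ⟨k, rfl⟩ : ∃ k, q = p + 1 + k := ⟨q - (p + 1), by omega⟩
      have h₃ := J_add_of_fixed hp1 hp k (by omega)
      omega
    exact next_fixed_of_pure hq hodd v (by omega) (by omega) (by omega) h₂
      (fun k hk => hnext k (by omega))
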